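/- A fuzzy metric space (X,M,*) is Lebesgue if and only if every bounded real-valued continuous function on (X,τ_M) is R-uniformly continuous as a mapping from (X,M,*) to ℝ. -/

import Mathlib

open Filter Topology Set

/-- A fuzzy metric space in the sense of George and Veeramani: a continuous
t-norm `star` on `[0,1]` together with a fuzzy set `M` on `X × X × (0,∞)`. -/
structure FuzzyMetric (X : Type*) where
  M : X → X → ℝ → ℝ
  star : ℝ → ℝ → ℝ
  star_mem : ∀ a ∈ Set.Icc (0:ℝ) 1, ∀ b ∈ Set.Icc (0:ℝ) 1, star a b ∈ Set.Icc (0:ℝ) 1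
  star_comm : ∀ a ∈ Set.Icc (0:ℝ) 1, ∀ b ∈ Set.Icc (0:ℝ) 1, star a b = star b a
  star_assoc : ∀ a ∈ Set.Icc (0:ℝ) 1, ∀ b ∈ Set.Icc (0:ℝ) 1, ∀ c ∈ Set.Icc (0:ℝ) 1,
    star (star a b) c = star a (star b c)
  star_one : ∀ a ∈ Set.Icc (0:ℝ) 1, star a 1 = a
  star_mono : ∀ a b c d : ℝ, a ∈ Set.Icc (0:ℝ) 1 → b ∈ Set.Icc (0:ℝ) 1 →
    c ∈ Set.Icc (0:ℝ) 1 → d ∈ Set.Icc (0:ℝ) 1 → a ≤ b → c ≤ d → star a c ≤ star b d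
  star_continuous : ContinuousOn (fun p : ℝ × ℝ => star p.1 p.2)
    (Set.Icc (0:ℝ) 1 ×ˢ Set.Icc (0:ℝ) 1)
  M_pos : ∀ x y t, 0 < t → 0 < M x y t
  M_le_one : ∀ x y t, 0 < t → M x y t ≤ 1
  M_eq_one_iff : ∀ x y t, 0 < t → (M x y t = 1 ↔ x = y)
  M_symm : ∀ x y t, 0 < t → M x y t = M y x t
  M_triangle : ∀ x y z t s, 0 < t → 0 < s → star (M x y t) (M y z s) ≤ M x z (t + s)
  M_continuousOn : ∀ x y, ContinuousOn (M x y) (Set.Ioi (0:ℝ))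

namespace FuzzyMetric

variable {X : Type*}

/-- The open ball `B(x,r,t)`. -/
def ball (F : FuzzyMetric X) (x : X) (r t : ℝ) : Set X := {y | 1 - r < F.M x y t}

/-- The topology `τ_M` induced by the fuzzy metric (the balls form a base for it). -/
def topology (F : FuzzyMetric X) : TopologicalSpace X :=
  TopologicalSpace.generateFrom
    {s | ∃ x : X, ∃ r t : ℝ, r ∈ Set.Ioo (0:ℝ) 1 ∧ 0 < t ∧ s = F.ball x r t}

/-- `f : X → ℝ` is `ℝ`-uniformly continuous. -/
def RUniformlyContinuous (F : FuzzyMetric X) (f : X → ℝ) : Prop :=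
  ∀ ε > (0:ℝ), ∃ r ∈ Set.Ioo (0:ℝ) 1, ∃ s > (0:ℝ),
    ∀ x y : X, 1 - r < F.M x y s → |f x - f y| < ε

/-- The Lebesgue property: every open cover is refined by the family of balls of
some fixed radius `r` and parameter `t`. -/
def Lebesgue (F : FuzzyMetric X) : Prop :=
  ∀ 𝒢 : Set (Set X), (∀ G ∈ 𝒢, F.topology.IsOpen G) → ⋃₀ 𝒢 = Set.univ →
    ∃ r ∈ Set.Ioo (0:ℝ) 1, ∃ t > (0:ℝ), ∀ x : X, ∃ G ∈ 𝒢, F.ball x r t ⊆ G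

/-- A set `A ⊆ X` is fuzzy uniformly discrete. -/
def UniformlyDiscrete (F : FuzzyMetric X) (A : Set X) : Prop :=
  ∃ r ∈ Set.Ioo (0:ℝ) 1, ∃ s > (0:ℝ), ∀ x ∈ A, ∀ y ∈ A, x ≠ y → F.M x y s < 1 - r

/-- The set `X'` of accumulation points of `(X, τ_M)`. -/
def derivedSet (F : FuzzyMetric X) : Set X :=
  {x | ∀ U : Set X, F.topology.IsOpen U → x ∈ U → ∃ y ∈ U, y ≠ x}

/-- A sequence is Cauchy in the fuzzy metric. -/
def IsCauchy (F : FuzzyMetric X) (u : ℕ → X) : Prop :=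
  ∀ ε ∈ Set.Ioo (0:ℝ) 1, ∀ t > (0:ℝ), ∃ k : ℕ, ∀ m ≥ k, ∀ n ≥ k, 1 - ε < F.M (u m) (u n) t

/-- Sequential compactness: every sequence has a convergent subsequence. -/
def SeqCompact (F : FuzzyMetric X) : Prop :=
  ∀ u : ℕ → X, ∃ x : X, ∃ φ : ℕ → ℕ, StrictMono φ ∧
    Filter.Tendsto (u ∘ φ) Filter.atTop (@nhds X F.topology x)

end FuzzyMetric

open scoped Uniformity

namespace FuzzyMetric

variable {X : Type*} (F : FuzzyMetric X)

theorem M_mem_Icc (x y : X) {t : ℝ} (ht : 0 < t) : F.M x y t ∈ Set.Icc (0 : ℝ) 1 :=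
  ⟨(F.M_pos x y t ht).le, F.M_le_one x y t ht⟩

theorem M_self (x : X) {t : ℝ} (ht : 0 < t) : F.M x x t = 1 :=
  (F.M_eq_one_iff x x t ht).2 rfl

theorem M_mono (x y : X) {s t : ℝ} (hs : 0 < s) (hst : s ≤ t) : F.M x y s ≤ F.M x y t := by
  rcases hst.eq_or_lt with rfl | hlt
  · exact le_rfl
  · have h := F.M_triangle x y y s (t - s) hs (sub_pos.2 hlt)
    rwa [F.M_self y (sub_pos.2 hlt), F.star_one _ (F.M_mem_Icc x y hs), add_sub_cancel] at h

/-- Lower semicontinuity of the t-norm at `(a, 1)`. -/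
theorem exists_lt_star {a c : ℝ} (ha : a ∈ Set.Icc (0 : ℝ) 1) (hc : c < a) :
    ∃ δ > 0, ∀ a' ∈ Set.Icc (0 : ℝ) 1, ∀ b ∈ Set.Icc (0 : ℝ) 1,
      a - δ < a' → 1 - δ < b → c < F.star a' b := by
  have h1 : (1 : ℝ) ∈ Set.Icc (0 : ℝ) 1 := ⟨zero_le_one, le_rfl⟩
  obtain ⟨δ, hδ, H⟩ := Metric.continuousOn_iff.1 F.star_continuous (a, 1) ⟨ha, h1⟩ (a - c)
    (sub_pos.2 hc)
  refine ⟨δ, hδ, fun a' ha' b hb haa hbb => ?_⟩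
  have hm : min a' a ∈ Set.Icc (0 : ℝ) 1 := ⟨le_min ha'.1 ha.1, (min_le_right _ _).trans ha.2⟩
  have hlt : a - δ < min a' a := lt_min haa (by linarith)
  have h := H (min a' a, b) ⟨hm, hb⟩ (by
    rw [Prod.dist_eq, max_lt_iff, Real.dist_eq, Real.dist_eq, abs_lt, abs_lt]
    have := min_le_right a' a
    have := hb.2
    refine ⟨⟨?_, ?_⟩, ?_, ?_⟩ <;> dsimp only <;> linarith)
  rw [F.star_one a ha, Real.dist_eq, abs_lt] at h
  have := F.star_mono _ _ _ _ hm ha' hb hb (min_le_left _ _) le_rfl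
  linarith [h.1]

/-- The basic entourage with parameters `r` and `t`. -/
def entourage (r t : ℝ) : Set (X × X) := {p | 1 - r < F.M p.1 p.2 t}

theorem entourage_mono {r r' t t' : ℝ} (ht : 0 < t) (hr : r ≤ r') (htt : t ≤ t') :
    F.entourage r t ⊆ F.entourage r' t' := fun p (hp : 1 - r < F.M p.1 p.2 t) =>
  show 1 - r' < F.M p.1 p.2 t' by linarith [F.M_mono p.1 p.2 ht htt]

/-- The filter of entourages of a fuzzy metric. -/
def uniformityFilter : Filter (X × X) :=
  ⨅ n : ℕ, 𝓟 (F.entourage (1 / ((n : ℝ) + 1)) (1 / ((n : ℝ) + 1)))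

theorem mem_uniformityFilter {s : Set (X × X)} :
    s ∈ F.uniformityFilter ↔ ∃ ε > 0, F.entourage ε ε ⊆ s := by
  have hanti : Antitone fun n : ℕ => F.entourage (1 / ((n : ℝ) + 1)) (1 / ((n : ℝ) + 1)) :=
    fun m n hmn => F.entourage_mono Nat.one_div_pos_of_nat (Nat.one_div_le_one_div hmn)
      (Nat.one_div_le_one_div hmn)
  rw [uniformityFilter, (HasAntitoneBasis.iInf_principal hanti).mem_iff]
  constructor
  · rintro ⟨n, hn⟩
    exact ⟨_, Nat.one_div_pos_of_nat, hn⟩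
  · rintro ⟨ε, hε, h⟩
    obtain ⟨n, hn⟩ := exists_nat_one_div_lt hε
    exact ⟨n, (F.entourage_mono Nat.one_div_pos_of_nat hn.le hn.le).trans h⟩

theorem mem_uniformityFilter_iff_exists_Ioo {s : Set (X × X)} :
    s ∈ F.uniformityFilter ↔
      ∃ r ∈ Set.Ioo (0 : ℝ) 1, ∃ t > (0 : ℝ), F.entourage r t ⊆ s := by
  rw [mem_uniformityFilter]
  constructor
  · rintro ⟨ε, hε, h⟩
    refine ⟨min ε (1 / 2), ⟨by positivity, (min_le_right _ _).trans_lt (by norm_num)⟩, ε, hε, ?_⟩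
    exact (F.entourage_mono hε (min_le_left _ _) le_rfl).trans h
  · rintro ⟨r, hr, t, ht, h⟩
    have hm : 0 < min r t := lt_min hr.1 ht
    exact ⟨min r t, hm, (F.entourage_mono hm (min_le_left _ _) (min_le_right _ _)).trans h⟩

/-- The uniformity core of a fuzzy metric. -/
def uniformCore : UniformSpace.Core X where
  uniformity := F.uniformityFilter
  refl := by
    intro s hs
    obtain ⟨ε, hε, h⟩ := F.mem_uniformityFilter.1 hs
    rintro ⟨x, y⟩ (rfl : x = y)
    exact h (show 1 - ε < F.M x x ε by rw [F.M_self x hε]; linarith)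
  symm := by
    intro s hs
    obtain ⟨ε, hε, h⟩ := F.mem_uniformityFilter.1 hs
    refine F.mem_uniformityFilter.2 ⟨ε, hε, fun p hp => h ?_⟩
    change 1 - ε < F.M p.2 p.1 ε
    rw [F.M_symm _ _ _ hε]
    exact hp
  comp := by
    intro s hs
    obtain ⟨ε, hε, h⟩ := F.mem_uniformityFilter.1 hs
    obtain ⟨δ, hδ, H⟩ := F.exists_lt_star (a := 1) (c := 1 - ε) ⟨zero_le_one, le_rfl⟩
      (by linarith)
    have hm : 0 < min δ (ε / 2) := by positivity
    refine Filter.mem_of_superset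
      (Filter.mem_lift' (F.mem_uniformityFilter.2 ⟨min δ (ε / 2), hm, Subset.rfl⟩)) ?_
    rintro ⟨x, z⟩ ⟨y, hxy, hyz⟩
    refine h ?_
    change 1 - min δ (ε / 2) < F.M x y (min δ (ε / 2)) at hxy
    change 1 - min δ (ε / 2) < F.M y z (min δ (ε / 2)) at hyz
    change 1 - ε < F.M x z ε
    have h1 := min_le_left δ (ε / 2)
    have h2 := min_le_right δ (ε / 2)
    calc 1 - ε < F.star (F.M x y (min δ (ε / 2))) (F.M y z (min δ (ε / 2))) :=
          H _ (F.M_mem_Icc _ _ hm) _ (F.M_mem_Icc _ _ hm) (by linarith) (by linarith)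
      _ ≤ F.M x z (min δ (ε / 2) + min δ (ε / 2)) := F.M_triangle _ _ _ _ _ hm hm
      _ ≤ F.M x z ε := F.M_mono _ _ (by linarith) (by linarith)

theorem exists_ball_subset_ball {x y : X} {r t : ℝ} (ht : 0 < t) (hy : y ∈ F.ball x r t) :
    ∃ ε > 0, F.ball y ε ε ⊆ F.ball x r t := by
  have hcont := (F.M_continuousOn x y).continuousAt (Ioi_mem_nhds ht)
  have hev : ∀ᶠ t' in 𝓝[<] t, 1 - r < F.M x y t' :=
    (hcont.eventually_const_lt hy).filter_mono nhdsWithin_le_nhds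
  obtain ⟨t', ⟨h1, ht'0⟩, ht't⟩ := ((hev.and (nhdsWithin_le_nhds (Ioi_mem_nhds ht))).and
    self_mem_nhdsWithin).exists
  change 0 < t' at ht'0
  change t' < t at ht't
  obtain ⟨δ, hδ, H⟩ := F.exists_lt_star (F.M_mem_Icc x y ht'0) h1
  have hm : 0 < min δ (t - t') := lt_min hδ (sub_pos.2 ht't)
  refine ⟨_, hm, fun z (hz : 1 - min δ (t - t') < F.M y z (min δ (t - t'))) => ?_⟩
  have h2 := min_le_left δ (t - t')
  have h3 := min_le_right δ (t - t')
  calc 1 - r < F.star (F.M x y t') (F.M y z (min δ (t - t'))) :=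
        H _ (F.M_mem_Icc _ _ ht'0) _ (F.M_mem_Icc _ _ hm) (by linarith) (by linarith)
    _ ≤ F.M x z (t' + min δ (t - t')) := F.M_triangle _ _ _ _ _ ht'0 hm
    _ ≤ F.M x z t := F.M_mono _ _ (by linarith) (by linarith)

theorem mem_ball_self (x : X) {r t : ℝ} (hr : 0 < r) (ht : 0 < t) : x ∈ F.ball x r t := by
  change 1 - r < F.M x x t
  rw [F.M_self x ht]
  linarith

theorem topology_eq : F.topology = F.uniformCore.toTopologicalSpace := by
  have hnhds : ∀ (x : X) (s : Set X),
      s ∈ @nhds X F.uniformCore.toTopologicalSpace x ↔ ∃ ε > 0, F.ball x ε ε ⊆ s := by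
    intro x s
    rw [UniformSpace.Core.nhds_toTopologicalSpace, mem_comap]
    constructor
    · rintro ⟨V, hV, h⟩
      obtain ⟨ε, hε, hεV⟩ := F.mem_uniformityFilter.1 hV
      exact ⟨ε, hε, fun y hy => h (hεV (a := (x, y)) hy)⟩
    · rintro ⟨ε, hε, h⟩
      exact ⟨_, F.mem_uniformityFilter.2 ⟨ε, hε, Subset.rfl⟩, fun y hy => h hy⟩
  refine le_antisymm (fun s hs => ?_) (le_generateFrom ?_)
  · refine (@isOpen_iff_forall_mem_open X F.topology s).2 fun x hx => ?_
    obtain ⟨ε, hε, h⟩ := (hnhds x s).1 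
      (@IsOpen.mem_nhds X F.uniformCore.toTopologicalSpace x s hs hx)
    have hm : 0 < min ε (1 / 2) := by positivity
    refine ⟨F.ball x (min ε (1 / 2)) ε, fun y hy => h ?_,
      .basic _ ⟨x, _, ε, ⟨hm, (min_le_right _ _).trans_lt (by norm_num)⟩, hε, rfl⟩,
      F.mem_ball_self x hm hε⟩
    exact F.entourage_mono hε (min_le_left _ _) le_rfl (a := (x, y)) hy
  · rintro _ ⟨x, r, t, -, ht, rfl⟩
    exact (@isOpen_iff_mem_nhds X F.uniformCore.toTopologicalSpace _).2 fun y hy =>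
      (hnhds y _).2 (F.exists_ball_subset_ball ht hy)

/-- The uniform structure of a fuzzy metric, inducing the topology `F.topology`. -/
@[reducible] def uniformSpace : UniformSpace X :=
  @UniformSpace.replaceTopology X F.topology (UniformSpace.ofCore F.uniformCore) F.topology_eq

theorem mem_uniformity {s : Set (X × X)} :
    s ∈ 𝓤[F.uniformSpace] ↔ ∃ r ∈ Set.Ioo (0 : ℝ) 1, ∃ t > (0 : ℝ), F.entourage r t ⊆ s :=
  F.mem_uniformityFilter_iff_exists_Ioo

theorem isCountablyGenerated_uniformity : (𝓤[F.uniformSpace]).IsCountablyGenerated :=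
  isCountablyGenerated_seq _

theorem t0Space : @T0Space X F.topology := by
  let := F.uniformSpace
  refine t0Space_iff_uniformity.2 fun x y h => (F.M_eq_one_iff x y 1 one_pos).1 ?_
  refine (F.M_le_one x y 1 one_pos).antisymm (le_of_forall_pos_lt_add fun ε hε => ?_)
  have hm : min ε (1 / 2) ∈ Set.Ioo (0 : ℝ) 1 :=
    ⟨by positivity, (min_le_right _ _).trans_lt (by norm_num)⟩
  have h1 : 1 - min ε (1 / 2) < F.M x y 1 :=
    h _ (F.mem_uniformity.2 ⟨_, hm, 1, one_pos, Subset.rfl⟩)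
  linarith [min_le_left ε (1 / 2)]

theorem rUniformlyContinuous_iff (f : X → ℝ) :
    F.RUniformlyContinuous f ↔ @UniformContinuous X ℝ F.uniformSpace _ f := by
  let := F.uniformSpace
  refine Iff.trans ?_ Metric.uniformity_basis_dist.tendsto_right_iff.symm
  exact forall₂_congr fun ε _ => Iff.trans
    (by simp only [entourage, subset_def, Prod.forall]; rfl) F.mem_uniformity.symm

theorem lebesgue_iff :
    F.Lebesgue ↔ ∀ 𝒢 : Set (Set X), (∀ G ∈ 𝒢, F.topology.IsOpen G) → ⋃₀ 𝒢 = Set.univ →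
      ∃ V ∈ 𝓤[F.uniformSpace], ∀ x, ∃ G ∈ 𝒢, UniformSpace.ball x V ⊆ G := by
  refine forall₃_congr fun 𝒢 _ _ => ⟨?_, ?_⟩
  · rintro ⟨r, hr, t, ht, h⟩
    exact ⟨_, F.mem_uniformity.2 ⟨r, hr, t, ht, Subset.rfl⟩, h⟩
  · rintro ⟨V, hV, h⟩
    obtain ⟨r, hr, t, ht, hrt⟩ := F.mem_uniformity.1 hV
    refine ⟨r, hr, t, ht, fun x => ?_⟩
    obtain ⟨G, hG, hx⟩ := h x
    exact ⟨G, hG, fun y hy => hx (hrt (a := (x, y)) hy)⟩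

end FuzzyMetric

/-- A continuous function is uniformly continuous when every open cover has a uniform refinement. -/
theorem uniformContinuous_of_forall_cover {X : Type*} [UniformSpace X]
    (h : ∀ 𝒢 : Set (Set X), (∀ G ∈ 𝒢, IsOpen G) → ⋃₀ 𝒢 = Set.univ →
      ∃ V ∈ 𝓤 X, ∀ x, ∃ G ∈ 𝒢, UniformSpace.ball x V ⊆ G)
    {f : X → ℝ} (hf : Continuous f) : UniformContinuous f := by
  refine Metric.uniformity_basis_dist.tendsto_right_iff.2 fun ε hε => ?_
  obtain ⟨V, hV, hVG⟩ := h (range fun c => f ⁻¹' Metric.ball c (ε / 2))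
    (forall_mem_range.2 fun c => Metric.isOpen_ball.preimage hf)
    (sUnion_eq_univ_iff.2 fun x => ⟨_, ⟨f x, rfl⟩, Metric.mem_ball_self (half_pos hε)⟩)
  filter_upwards [hV] with p hp
  obtain ⟨_, ⟨c, rfl⟩, hsub⟩ := hVG p.1
  have h1 : dist (f p.1) c < ε / 2 := hsub (refl_mem_uniformity hV)
  have h2 : dist (f p.2) c < ε / 2 := hsub hp
  change dist (f p.1) (f p.2) < ε
  linarith [dist_triangle_right (f p.1) (f p.2) c]

theorem isClosed_range_of_tendsto_zero {X : Type*} [TopologicalSpace X] [T1Space X] {g : X → ℝ}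
    (hg : Continuous g) (hpos : ∀ x, 0 < g x) {u : ℕ → X}
    (hu : Tendsto (g ∘ u) atTop (𝓝 0)) : IsClosed (range u) := by
  rw [← iUnion_singleton_eq_range]
  refine LocallyFinite.isClosed_iUnion (fun x => ?_) fun n => isClosed_singleton
  refine ⟨{y | g x / 2 < g y}, (isOpen_lt continuous_const hg).mem_nhds
    (half_lt_self (hpos x)), ?_⟩
  have hev := hu.eventually_lt_const (half_pos (hpos x))
  rw [← Nat.cofinite_eq_atTop] at hev
  refine hev.subset ?_
  rintro n ⟨y, rfl, hy⟩ hn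
  exact lt_asymm (show g x / 2 < g (u n) from hy) hn

/-- If all bounded continuous functions on a metric space are uniformly continuous, then every
open cover has a Lebesgue number. Otherwise there are sequences of ever closer pairs of points with
disjoint closed ranges, and a Urysohn function separating the ranges is not uniformly continuous. -/
theorem exists_ball_subset_of_forall_uniformContinuous {X : Type*} [MetricSpace X]
    (h : ∀ f : X → ℝ, Continuous f → (∃ C, ∀ x, |f x| ≤ C) → UniformContinuous f)
    {𝒢 : Set (Set X)} (hopen : ∀ G ∈ 𝒢, IsOpen G) (hcov : ⋃₀ 𝒢 = Set.univ) :
    ∃ δ > 0, ∀ x, ∃ G ∈ 𝒢, Metric.ball x δ ⊆ G := by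
  by_contra! hcon
  obtain ⟨g, hg⟩ : ∃ g : C(X, ℝ), ∀ x, g x ∈ {r : ℝ | 0 < r ∧ ∃ G ∈ 𝒢, Metric.ball x r ⊆ G} := by
    refine exists_continuous_forall_mem_convex_of_local_const (fun x => ?_) fun x => ?_
    · refine Set.OrdConnected.convex ⟨?_⟩
      rintro a ⟨ha, -⟩ b ⟨-, G, hG, hb⟩ c hc
      exact ⟨ha.trans_le hc.1, G, hG, (Metric.ball_subset_ball hc.2).trans hb⟩
    · obtain ⟨G, hG, hx⟩ := sUnion_eq_univ_iff.1 hcov x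
      obtain ⟨ε, hε, hball⟩ := Metric.isOpen_iff.1 (hopen G hG) x hx
      refine ⟨ε / 2, ?_⟩
      filter_upwards [Metric.ball_mem_nhds x (half_pos hε)] with y hy
      exact ⟨half_pos hε, G, hG, (Metric.ball_subset_ball' (by
        linarith [Metric.mem_ball.1 hy])).trans hball⟩
  have hpos : ∀ x, 0 < g x := fun x => (hg x).1
  have hsmall : ∀ ε > 0, ∃ p : X × X, p.1 ≠ p.2 ∧ g p.1 < ε ∧ g p.2 < ε ∧ dist p.1 p.2 < ε := by
    intro ε hε
    obtain ⟨x, hx⟩ := hcon (ε / 2) (half_pos hε)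
    have hlt : ∀ y, dist x y < ε / 2 → g y < ε := by
      intro y hy
      by_contra! hle
      obtain ⟨-, G, hG, hsub⟩ := hg y
      exact hx G hG ((Metric.ball_subset_ball' (by linarith)).trans hsub)
    obtain ⟨G, hG, hxG⟩ := sUnion_eq_univ_iff.1 hcov x
    obtain ⟨y, hy, hyG⟩ := not_subset.1 (hx G hG)
    rw [Metric.mem_ball'] at hy
    refine ⟨(x, y), ?_, hlt x (by simpa using half_pos hε), hlt y hy, hy.trans (half_lt_self hε)⟩
    rintro (rfl : x = y)
    exact hyG hxG
  let lower : X × X → ℝ := fun p => min (min (g p.1) (g p.2)) (dist p.1 p.2)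
  let upper : X × X → ℝ := fun p => max (max (g p.1) (g p.2)) (dist p.1 p.2)
  obtain ⟨u, hne, hu⟩ := exists_seq_of_forall_finset_exists (fun p : X × X => p.1 ≠ p.2)
    (fun p q => upper q < lower p / 2) fun s hs => by
      have hev : ∀ᶠ ε in 𝓝[>] (0 : ℝ), ∀ p ∈ s, ε < lower p / 2 := by
        refine (Finset.eventually_all s).2 fun p hp => nhdsWithin_le_nhds (Iio_mem_nhds ?_)
        exact half_pos (lt_min (lt_min (hpos _) (hpos _)) (dist_pos.2 (hs p hp)))
      obtain ⟨ε, hεs, hε⟩ := (hev.and self_mem_nhdsWithin).exists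
      obtain ⟨p, hp, h1, h2, h3⟩ := hsmall ε hε
      exact ⟨p, hp, fun q hq => (max_lt (max_lt h1 h2) h3).trans (hεs q hq)⟩
  have hlu : ∀ p, lower p ≤ upper p := fun p => (min_le_right _ _).trans (le_max_right _ _)
  have hupper : Tendsto (fun n => upper (u n)) atTop (𝓝 0) := by
    have hle : ∀ n, upper (u n) ≤ upper (u 0) * (1 / 2) ^ n := by
      intro n
      induction n with
      | zero => simp
      | succ n ih =>
        rw [pow_succ]
        linarith [hu n (n + 1) n.lt_succ_self, hlu (u n)]
    refine squeeze_zero (fun n => dist_nonneg.trans (le_max_right _ _)) hle ?_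
    simpa using (tendsto_pow_atTop_nhds_zero_of_lt_one (r := (1 / 2 : ℝ)) (by norm_num)
      (by norm_num)).const_mul (upper (u 0))
  have hA : IsClosed (range fun n => (u n).1) := isClosed_range_of_tendsto_zero g.continuous hpos
    (squeeze_zero (fun n => (hpos _).le) (fun n => (le_max_left _ _).trans (le_max_left _ _))
      hupper)
  have hB : IsClosed (range fun n => (u n).2) := isClosed_range_of_tendsto_zero g.continuous hpos
    (squeeze_zero (fun n => (hpos _).le) (fun n => (le_max_right _ _).trans (le_max_left _ _))
      hupper)
  have hdisj : Disjoint (range fun n => (u n).1) (range fun n => (u n).2) := by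
    rw [disjoint_left]
    rintro _ ⟨m, rfl⟩ ⟨n, hn⟩
    dsimp only at hn
    have hlower1 : ∀ k, lower (u k) ≤ g (u k).1 := fun k =>
      (min_le_left _ _).trans (min_le_left _ _)
    have hlower2 : ∀ k, lower (u k) ≤ g (u k).2 := fun k =>
      (min_le_left _ _).trans (min_le_right _ _)
    have hupper1 : ∀ k, g (u k).1 ≤ upper (u k) := fun k =>
      (le_max_left _ _).trans (le_max_left _ _)
    have hupper2 : ∀ k, g (u k).2 ≤ upper (u k) := fun k =>
      (le_max_right _ _).trans (le_max_left _ _)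
    have hgn := congrArg g hn
    rcases lt_trichotomy m n with hmn | rfl | hmn
    · linarith [hu m n hmn, hlower1 m, hupper2 n, hpos (u m).1]
    · exact hne m hn.symm
    · linarith [hu n m hmn, hlower2 n, hupper1 m, hpos (u n).2]
  obtain ⟨f, hf0, hf1, hf⟩ := exists_continuous_zero_one_of_isClosed hA hB hdisj
  obtain ⟨δ, hδ, H⟩ := Metric.uniformContinuous_iff.1
    (h f f.continuous ⟨1, fun x => abs_le.2 ⟨by linarith [(hf x).1], (hf x).2⟩⟩) 1 one_pos
  obtain ⟨n, hn⟩ := (hupper.eventually_lt_const hδ).exists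
  have h1 := H ((le_max_right _ _).trans_lt hn)
  rw [hf0 ⟨n, rfl⟩, hf1 ⟨n, rfl⟩] at h1
  norm_num at h1

/-- A uniform version of the Lebesgue property characterization by bounded continuous functions. -/
theorem forall_cover_iff_forall_bounded_uniformContinuous {X : Type*} [UniformSpace X] [T0Space X]
    [(𝓤 X).IsCountablyGenerated] :
    (∀ 𝒢 : Set (Set X), (∀ G ∈ 𝒢, IsOpen G) → ⋃₀ 𝒢 = Set.univ →
      ∃ V ∈ 𝓤 X, ∀ x, ∃ G ∈ 𝒢, UniformSpace.ball x V ⊆ G) ↔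
    ∀ f : X → ℝ, Continuous f → (∃ C : ℝ, ∀ x, |f x| ≤ C) → UniformContinuous f := by
  refine ⟨fun h f hf _ => uniformContinuous_of_forall_cover h hf, fun h 𝒢 hopen hcov => ?_⟩
  let := UniformSpace.metricSpace X
  obtain ⟨δ, hδ, H⟩ := exists_ball_subset_of_forall_uniformContinuous h hopen hcov
  refine ⟨_, Metric.dist_mem_uniformity hδ, fun x => ?_⟩
  obtain ⟨G, hG, hsub⟩ := H x
  exact ⟨G, hG, fun y hy => hsub (Metric.mem_ball'.2 hy)⟩


/-- A fuzzy metric space is Lebesgue iff every bounded real-valued continuous function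
on `(X, τ_M)` is `ℝ`-uniformly continuous. -/
theorem lebesgue_iff_bounded_continuous_rUniformlyContinuous {X : Type*} [Nonempty X]
    (F : FuzzyMetric X) :
    F.Lebesgue ↔
      ∀ f : X → ℝ, @Continuous X ℝ F.topology _ f → (∃ C : ℝ, ∀ x : X, |f x| ≤ C) →
        F.RUniformlyContinuous f := by
  let := F.uniformSpace
  have := F.t0Space
  have := F.isCountablyGenerated_uniformity
  rw [F.lebesgue_iff]
  simp only [F.rUniformlyContinuous_iff]
  exact forall_cover_iff_forall_bounded_uniformContinuous
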